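/- Let q ≠ r be two natural numbers, let D = D(q,r), and let t ≥ 1 be a real number. Then λ(A_q ∩ A_r) ≤ 1_{D≥1/2} · λ(A_q)·λ(A_r)·e^{2L_t(q,r)}·(1 + O(2^{ω_t(q,r)} log(4D)/D)), with an absolute implied constant. -/

import Mathlib

open MeasureTheory

/-- `A_q`: the set of `x ∈ [0,1]` with `|x - a/q| < ψ(q)/q` for some `a ∈ ℤ` coprime to `q`. -/
def Aset (ψ : ℕ → ℝ) (q : ℕ) : Set ℝ :=
  {x ∈ Set.Icc (0 : ℝ) 1 | ∃ a : ℤ, Int.gcd a (q : ℤ) = 1 ∧ |x - (a : ℝ) / q| < ψ q / q}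

/-- `D(q,r) = max(r ψ(q), q ψ(r)) / gcd(q,r)`. -/
noncomputable def Dfun (ψ : ℕ → ℝ) (q r : ℕ) : ℝ :=
  max ((r : ℝ) * ψ q) ((q : ℝ) * ψ r) / (Nat.gcd q r : ℝ)

/-- `L_t(q,r) = ∑_{p | qr/gcd(q,r)², p > t} 1/p`. -/
noncomputable def Lfun (t : ℝ) (q r : ℕ) : ℝ :=
  ∑ p ∈ (q * r / Nat.gcd q r ^ 2).primeFactors.filter (fun p : ℕ => t < (p : ℝ)), (1 : ℝ) / p

/-- `ω_t(q,r) = #{p prime : p | qr/gcd(q,r)², p ≤ t}`. -/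
noncomputable def omegaFun (t : ℝ) (q r : ℕ) : ℕ :=
  ((q * r / Nat.gcd q r ^ 2).primeFactors.filter (fun p : ℕ => (p : ℝ) ≤ t)).card

namespace OE
open Finset

noncomputable def cnt (N : Finset ℕ) (y : ℝ) : ℕ :=
  ((Icc 1 ⌊y⌋₊).filter (fun c => ∀ p ∈ N, ¬ p ∣ c)).card

lemma cnt_dvd (N : Finset ℕ) (y : ℝ) (d : ℕ) (hd : 0 < d)
    (hN : ∀ p ∈ N, Nat.Prime p) (hco : ∀ p ∈ N, ¬ p ∣ d) :
    ((Icc 1 ⌊y⌋₊).filter (fun c => (∀ p ∈ N, ¬ p ∣ c) ∧ d ∣ c)).card = cnt N (y / d) := by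
  unfold cnt
  symm
  rw [Nat.floor_div_natCast]
  apply Finset.card_bij (fun c _ => d * c)
  · intro c hc
    simp only [mem_filter, mem_Icc] at hc ⊢
    refine ⟨⟨Nat.mul_pos hd hc.1.1, ?_⟩, ?_, dvd_mul_right _ _⟩
    · have := (Nat.le_div_iff_mul_le hd).1 hc.1.2
      linarith [mul_comm c d]
    · intro p hp h
      rcases (hN p hp).dvd_mul.1 h with h | h
      · exact hco p hp h
      · exact hc.2 p hp h
  · intro a _ b _ h
    exact Nat.eq_of_mul_eq_mul_left hd h
  · intro b hb
    simp only [mem_filter, mem_Icc] at hb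
    obtain ⟨c, rfl⟩ := hb.2.2
    refine ⟨c, ?_, rfl⟩
    simp only [mem_filter, mem_Icc]
    refine ⟨⟨Nat.pos_of_mul_pos_left (by omega : 0 < d * c) |> fun h => ?_, ?_⟩, ?_⟩
    · rcases Nat.eq_zero_or_pos c with h0 | h0
      · subst h0; simp at hb
      · exact h0
    · rw [Nat.le_div_iff_mul_le hd]; linarith [mul_comm c d, hb.1.2]
    · intro p hp h
      exact hb.2.1 p hp (h.mul_left d)

lemma cnt_step (N : Finset ℕ) (y : ℝ) (q : ℕ) (hq : q.Prime) (hqN : q ∉ N)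
    (hN : ∀ p ∈ N, Nat.Prime p) :
    cnt (insert q N) y + cnt N (y / q) = cnt N y := by
  rw [← cnt_dvd N y q hq.pos hN]
  · unfold cnt
    rw [← Finset.card_filter_add_card_filter_not (s := (Icc 1 ⌊y⌋₊).filter (fun c => ∀ p ∈ N, ¬ p ∣ c)) (fun c => q ∣ c),
      filter_filter, filter_filter, add_comm]
    congr 2
    ext c
    simp only [mem_filter, mem_insert, forall_eq_or_imp]
    tauto
  · intro p hp h
    rw [Nat.prime_dvd_prime_iff_eq (hN p hp) hq] at h
    exact hqN (h ▸ hp)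

noncomputable def al (N : Finset ℕ) : ℝ := ∏ p ∈ N, (1 - 1 / (p : ℝ))

lemma cnt_bound (N : Finset ℕ) : (∀ p ∈ N, Nat.Prime p) → ∀ y : ℝ, 0 ≤ y →
    |(cnt N y : ℝ) - al N * y| ≤ 2 ^ N.card := by
  induction N using Finset.induction_on with
  | empty =>
    intro _ y hy
    simp only [cnt, al, prod_empty, notMem_empty, card_empty, pow_zero]
    simp
    rw [abs_le]
    constructor
    · linarith [Nat.lt_floor_add_one y]
    · linarith [Nat.floor_le hy]
  | insert q N hq ih =>
    intro hN y hy
    have hqp := hN q (mem_insert_self _ _)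
    have hN' : ∀ p ∈ N, Nat.Prime p := fun p hp => hN p (mem_insert_of_mem hp)
    have h1 := ih hN' y hy
    have h2 := ih hN' (y / q) (by positivity)
    have h3 : (cnt (insert q N) y : ℝ) + cnt N (y / q) = cnt N y := by
      exact_mod_cast cnt_step N y q hqp hq hN'
    rw [card_insert_of_notMem hq, pow_succ]
    have h4 : al (insert q N) * y = al N * y - al N * (y / q) := by
      unfold al
      rw [prod_insert hq]; ring
    rw [h4]
    rw [abs_le] at *
    constructor <;> linarith [h1.1, h1.2, h2.1, h2.2]

lemma cnt_le (N : Finset ℕ) (y : ℝ) (hy : 0 ≤ y) : (cnt N y : ℝ) ≤ y := by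
  have : cnt N y ≤ ⌊y⌋₊ := by
    unfold cnt
    refine (card_filter_le _ _).trans ?_
    simp
  exact (Nat.cast_le.2 this).trans (Nat.floor_le hy)

lemma cnt_zero (N : Finset ℕ) (y : ℝ) (hy : y < 1) : cnt N y = 0 := by
  unfold cnt
  rw [Nat.floor_eq_zero.2 hy]; simp

noncomputable def u (p : ℕ) : ℝ := 1 - 1 / ((p : ℝ) - 1) ^ 2
noncomputable def v (p : ℕ) : ℝ := (p : ℝ) / ((p : ℝ) - 1) ^ 2

lemma two_le {p : ℕ} (hp : p.Prime) : (2 : ℝ) ≤ p := by exact_mod_cast hp.two_le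

lemma u_nonneg {p : ℕ} (hp : p.Prime) : 0 ≤ u p := by
  have := two_le hp
  unfold u
  rw [sub_nonneg, div_le_one (by nlinarith)]
  nlinarith
lemma u_le {p : ℕ} : u p ≤ 1 := by
  unfold u
  have : 0 ≤ 1 / ((p : ℝ) - 1) ^ 2 := by positivity
  linarith
lemma v_nonneg (p : ℕ) : 0 ≤ v p := by unfold v; positivity
lemma uv {p : ℕ} (hp : p.Prime) : v p / p + u p = 1 := by
  have := two_le hp
  have h1 : (p : ℝ) - 1 ≠ 0 := by intro h; linarith
  have h2 : (p : ℝ) ≠ 0 := by intro h; linarith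
  unfold u v
  field_simp
  ring
lemma v_ge {p : ℕ} (hp : p.Prime) : 1 / (p : ℝ) ≤ v p := by
  have := two_le hp
  unfold v
  rw [div_le_div_iff₀ (by linarith) (by nlinarith)]
  nlinarith
lemma v_le {p : ℕ} (hp : p.Prime) : v p ≤ 1 / (p : ℝ) + 6 / (p : ℝ) ^ 2 := by
  have := two_le hp
  have h2 : (p : ℝ) ≠ 0 := by intro h; linarith
  unfold v
  have : 1 / (p : ℝ) + 6 / (p : ℝ) ^ 2 = (p + 6) / (p : ℝ) ^ 2 := by field_simp
  rw [this, div_le_div_iff₀ (by nlinarith) (by nlinarith)]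
  nlinarith [mul_nonneg (sub_nonneg.2 (two_le hp)) (sub_nonneg.2 (two_le hp))]

noncomputable def F (P : Finset ℕ) (c : ℕ) : ℝ := ∏ p ∈ P, ((if p ∣ c then v p else 0) + u p)

lemma F_nonneg (P : Finset ℕ) (hP : ∀ p ∈ P, Nat.Prime p) (c : ℕ) : 0 ≤ F P c := by
  unfold F
  refine prod_nonneg fun p hp => add_nonneg ?_ (u_nonneg (hP p hp))
  split_ifs
  · exact v_nonneg p
  · rfl

noncomputable def T (N P : Finset ℕ) (x : ℝ) : ℝ :=
  ∑ c ∈ (Icc 1 ⌊x⌋₊).filter (fun c => ∀ p ∈ N, ¬ p ∣ c), F P c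

lemma prod_dvd_iff (S : Finset ℕ) (hS : ∀ p ∈ S, Nat.Prime p) (c : ℕ) :
    (∀ p ∈ S, p ∣ c) ↔ (∏ p ∈ S, p) ∣ c := by
  constructor
  · intro h
    exact Finset.prod_primes_dvd c (fun p hp => (hS p hp).prime) h
  · intro h p hp
    exact (dvd_prod_of_mem (fun p => p) hp).trans h

lemma T_eq (N P : Finset ℕ) (hN : ∀ p ∈ N, Nat.Prime p) (hP : ∀ p ∈ P, Nat.Prime p)
    (hd : Disjoint N P) (x : ℝ) :
    T N P x = ∑ S ∈ P.powerset, (∏ p ∈ S, v p) * (∏ p ∈ P \ S, u p) *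
      (cnt N (x / ((∏ p ∈ S, p : ℕ) : ℝ)) : ℝ) := by
  unfold T F
  simp_rw [prod_add]
  rw [sum_comm]
  refine sum_congr rfl fun S hS => ?_
  have hSP := mem_powerset.1 hS
  have hSp : ∀ p ∈ S, Nat.Prime p := fun p hp => hP p (hSP hp)
  rw [← cnt_dvd N x _ (prod_pos fun p hp => (hSp p hp).pos) hN]
  · simp_rw [prod_ite_zero, prod_dvd_iff S hSp]
    rw [← sum_mul, ← sum_filter, filter_filter, sum_const, nsmul_eq_mul]
    ring
  · intro p hp h
    rw [(hN p hp).prime.dvd_finsetProd_iff] at h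
    obtain ⟨a, ha, h⟩ := h
    rw [Nat.prime_dvd_prime_iff_eq (hN p hp) (hSp a ha)] at h
    exact (Finset.disjoint_left.1 hd hp) (h ▸ hSP ha)

lemma sum_main (P : Finset ℕ) (hP : ∀ p ∈ P, Nat.Prime p) :
    ∑ S ∈ P.powerset, (∏ p ∈ S, v p) * (∏ p ∈ P \ S, u p) / ((∏ p ∈ S, p : ℕ) : ℝ) = 1 := by
  have : ∏ p ∈ P, (v p / p + u p) = 1 := prod_eq_one fun p hp => uv (hP p hp)
  rw [prod_add] at this
  rw [← this]
  refine sum_congr rfl fun S _ => ?_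
  rw [prod_div_distrib]
  push_cast
  ring

noncomputable def VS (P : Finset ℕ) (f : ℕ → ℝ) (x : ℝ) : ℝ :=
  ∑ S ∈ P.powerset.filter (fun S => ((∏ p ∈ S, p : ℕ) : ℝ) ≤ x), ∏ p ∈ S, f p

lemma T_le (N P : Finset ℕ) (hN : ∀ p ∈ N, Nat.Prime p) (hP : ∀ p ∈ P, Nat.Prime p)
    (hd : Disjoint N P) (x : ℝ) (hx : 0 ≤ x) :
    T N P x ≤ al N * x + 2 ^ N.card * VS P v x := by
  rw [T_eq N P hN hP hd]
  have hal : 0 ≤ al N := prod_nonneg fun p hp => by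
    have := two_le (hN p hp)
    rw [sub_nonneg, div_le_one (by linarith)]; linarith
  have e1 : al N * x = ∑ S ∈ P.powerset, al N * x * ((∏ p ∈ S, v p) * (∏ p ∈ P \ S, u p) / ((∏ p ∈ S, p : ℕ) : ℝ)) := by
    rw [← mul_sum, sum_main P hP, mul_one]
  rw [e1]
  unfold VS
  rw [mul_sum, sum_filter, ← sum_add_distrib]
  refine sum_le_sum fun S hS => ?_
  have hSP := mem_powerset.1 hS
  have hSp : ∀ p ∈ S, Nat.Prime p := fun p hp => hP p (hSP hp)
  have hpos : (0 : ℝ) < ((∏ p ∈ S, p : ℕ) : ℝ) := by exact_mod_cast prod_pos fun p hp => (hSp p hp).pos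
  have hV : 0 ≤ ∏ p ∈ S, v p := prod_nonneg fun p _ => v_nonneg p
  have hU : 0 ≤ ∏ p ∈ P \ S, u p := prod_nonneg fun p hp => u_nonneg (hP p (mem_sdiff.1 hp).1)
  have hU1 : ∏ p ∈ P \ S, u p ≤ 1 := prod_le_one (fun p hp => u_nonneg (hP p (mem_sdiff.1 hp).1)) fun p _ => u_le
  split_ifs with h
  · have h1 := (abs_le.1 (cnt_bound N hN (x / ((∏ p ∈ S, p : ℕ) : ℝ)) (by positivity))).2
    have h2 : (cnt N (x / ((∏ p ∈ S, p : ℕ) : ℝ)) : ℝ) ≤ al N * (x / ((∏ p ∈ S, p : ℕ) : ℝ)) + 2 ^ N.card := by linarith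
    have h3 := mul_le_mul_of_nonneg_left h2 (mul_nonneg hV hU)
    refine h3.trans ?_
    have h4 : (∏ p ∈ S, v p) * (∏ p ∈ P \ S, u p) * 2 ^ N.card ≤ 2 ^ N.card * ∏ p ∈ S, v p := by
      have := mul_le_mul_of_nonneg_left hU1 hV
      nlinarith [pow_pos (two_pos : (0:ℝ) < 2) N.card]
    rw [mul_add]
    refine add_le_add (le_of_eq (by ring)) h4
  · rw [cnt_zero]
    · simp; positivity
    · rw [div_lt_one hpos]; linarith

lemma T_le_triv (N P : Finset ℕ) (hN : ∀ p ∈ N, Nat.Prime p) (hP : ∀ p ∈ P, Nat.Prime p)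
    (hd : Disjoint N P) (x : ℝ) (hx : 0 ≤ x) :
    T N P x ≤ x := by
  rw [T_eq N P hN hP hd]
  have e1 : x = ∑ S ∈ P.powerset, x * ((∏ p ∈ S, v p) * (∏ p ∈ P \ S, u p) / ((∏ p ∈ S, p : ℕ) : ℝ)) := by
    rw [← mul_sum, sum_main P hP, mul_one]
  conv_rhs => rw [e1]
  refine sum_le_sum fun S hS => ?_
  have hSP := mem_powerset.1 hS
  have hSp : ∀ p ∈ S, Nat.Prime p := fun p hp => hP p (hSP hp)
  have hV : 0 ≤ ∏ p ∈ S, v p := prod_nonneg fun p _ => v_nonneg p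
  have hU : 0 ≤ ∏ p ∈ P \ S, u p := prod_nonneg fun p hp => u_nonneg (hP p (mem_sdiff.1 hp).1)
  refine (mul_le_mul_of_nonneg_left (cnt_le N _ (by positivity)) (mul_nonneg hV hU)).trans (le_of_eq (by ring))
end OE

namespace OE
open Finset

lemma exp_bd {x : ℝ} (h0 : 0 ≤ x) (h1 : x ≤ 1 / 2) : Real.exp (-(2 * x)) ≤ 1 - x := by
  rw [Real.exp_neg]
  have h := Real.add_one_le_exp (2 * x)
  have hp : 0 < 2 * x + 1 := by linarith
  calc (Real.exp (2 * x))⁻¹ ≤ (2 * x + 1)⁻¹ := inv_anti₀ hp h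
    _ ≤ 1 - x := by
      rw [inv_le_iff_one_le_mul₀ hp]
      nlinarith

lemma sum_sq (Q : Finset ℕ) (hQ : ∀ p ∈ Q, Nat.Prime p) : ∑ p ∈ Q, 1 / (p : ℝ) ^ 2 ≤ 1 := by
  have hsub : Q ⊆ Ioc 1 (Q.sup id + 1) := by
    intro p hp
    rw [mem_Ioc]
    refine ⟨(hQ p hp).one_lt, ?_⟩
    have := Finset.le_sup (f := id) hp
    simp at this; omega
  calc ∑ p ∈ Q, 1 / (p : ℝ) ^ 2 ≤ ∑ p ∈ Ioc 1 (Q.sup id + 1), 1 / (p : ℝ) ^ 2 :=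
        sum_le_sum_of_subset_of_nonneg hsub (fun _ _ _ => by positivity)
    _ ≤ 1 := by
      have := sum_Ioc_inv_sq_le_sub (α := ℝ) (k := 1) (n := Q.sup id + 1) one_ne_zero (by omega)
      simp only [one_div]
      refine this.trans ?_
      have : (0 : ℝ) ≤ ((Q.sup id + 1 : ℕ) : ℝ)⁻¹ := by positivity
      simp only [Nat.cast_one, inv_one]
      linarith

lemma prod_six (Q : Finset ℕ) (hQ : ∀ p ∈ Q, Nat.Prime p) :
    ∏ p ∈ Q, (1 + 6 / (p : ℝ) ^ 2) ≤ Real.exp 6 := by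
  calc ∏ p ∈ Q, (1 + 6 / (p : ℝ) ^ 2) ≤ ∏ p ∈ Q, Real.exp (6 / (p : ℝ) ^ 2) := by
        refine prod_le_prod (fun _ _ => by positivity) fun p _ => ?_
        linarith [Real.add_one_le_exp (6 / (p : ℝ) ^ 2)]
    _ = Real.exp (6 * ∑ p ∈ Q, 1 / (p : ℝ) ^ 2) := by
        rw [← Real.exp_sum, mul_sum]
        congr 1
        exact sum_congr rfl fun _ _ => by ring
    _ ≤ _ := by
        apply Real.exp_le_exp.2
        linarith [sum_sq Q hQ]

lemma al_sig (N : Finset ℕ) (hN : ∀ p ∈ N, Nat.Prime p) :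
    Real.exp (-2) ≤ al N * ∏ p ∈ N, (1 + 1 / (p : ℝ)) := by
  unfold al
  rw [← prod_mul_distrib]
  calc Real.exp (-2) ≤ Real.exp (∑ p ∈ N, -(2 * (1 / (p : ℝ) ^ 2))) := by
        apply Real.exp_le_exp.2
        rw [sum_neg_distrib, ← mul_sum]
        linarith [sum_sq N hN]
    _ = ∏ p ∈ N, Real.exp (-(2 * (1 / (p : ℝ) ^ 2))) := Real.exp_sum _ _
    _ ≤ _ := by
        refine prod_le_prod (fun _ _ => (Real.exp_pos _).le) fun p hp => ?_
        have := two_le (hN p hp)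
        have h : 1 / (p : ℝ) ^ 2 ≤ 1 / 2 := by
          apply one_div_le_one_div_of_le two_pos; nlinarith
        refine (exp_bd (by positivity) h).trans (le_of_eq ?_)
        field_simp
        ring

lemma al_pos (N : Finset ℕ) (hN : ∀ p ∈ N, Nat.Prime p) : 0 < al N :=
  prod_pos fun p hp => by
    have := two_le (hN p hp)
    rw [sub_pos, div_lt_one (by linarith)]; linarith

lemma al_low (N : Finset ℕ) (hN : ∀ p ∈ N, Nat.Prime p) :
    3 / 4 * (2 / 3 : ℝ) ^ N.card ≤ al N := by
  have h : ∏ p ∈ N, (2 / 3 * (if p = 2 then (3 / 4 : ℝ) else 1)) ≤ al N := by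
    refine prod_le_prod (fun _ _ => by split_ifs <;> norm_num) fun p hp => ?_
    split_ifs with h
    · subst h; norm_num
    · have h3 : 3 ≤ p := by
        have := (hN p hp).two_le
        omega
      have h3' : (3 : ℝ) ≤ p := by exact_mod_cast h3
      have : 1 / (p : ℝ) ≤ 1 / 3 := one_div_le_one_div_of_le (by norm_num) h3'
      linarith
  refine le_trans ?_ h
  rw [prod_mul_distrib, prod_const, prod_ite_eq', mul_comm]
  refine mul_le_mul_of_nonneg_left ?_ (by positivity)
  split_ifs <;> norm_num

lemma VS_insert (Q : Finset ℕ) (f : ℕ → ℝ) (x : ℝ) (q : ℕ) (hq : q.Prime) (hqQ : q ∉ Q) :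
    VS (insert q Q) f x = VS Q f x + f q * VS Q f (x / q) := by
  unfold VS
  simp only [sum_filter]
  rw [sum_powerset_insert hqQ]
  congr 1
  rw [mul_sum]
  refine sum_congr rfl fun S hS => ?_
  have hqS : q ∉ S := fun h => hqQ (mem_powerset.1 hS h)
  rw [prod_insert hqS, prod_insert hqS]
  have : (((q * ∏ p ∈ S, p : ℕ) : ℝ) ≤ x) ↔ (((∏ p ∈ S, p : ℕ) : ℝ) ≤ x / q) := by
    rw [le_div_iff₀ (by exact_mod_cast hq.pos)]
    push_cast
    rw [mul_comm]
  simp only [this]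
  split_ifs <;> simp

lemma VS_nonneg (Q : Finset ℕ) (f : ℕ → ℝ) (hf : ∀ p, 0 ≤ f p) (x : ℝ) : 0 ≤ VS Q f x :=
  sum_nonneg fun _ _ => prod_nonneg fun p _ => hf p

lemma VS_mono (Q : Finset ℕ) (f : ℕ → ℝ) (hf : ∀ p, 0 ≤ f p) {x y : ℝ} (h : x ≤ y) :
    VS Q f x ≤ VS Q f y := by
  unfold VS
  refine sum_le_sum_of_subset_of_nonneg ?_ fun _ _ _ => prod_nonneg fun p _ => hf p
  intro S
  simp only [mem_filter]
  exact fun hS => ⟨hS.1, hS.2.trans h⟩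

lemma VS_le (Q : Finset ℕ) : (∀ p ∈ Q, Nat.Prime p) → ∀ x : ℝ, 0 ≤ x →
    VS Q v x ≤ (∏ p ∈ Q, (1 + 6 / (p : ℝ) ^ 2)) * VS Q (fun p => 1 / (p : ℝ)) x := by
  induction Q using Finset.induction_on with
  | empty => intro _ x _; simp only [VS, sum_filter, powerset_empty, sum_singleton, prod_empty, one_mul]; exact le_rfl
  | insert q Q hq ih =>
    intro hQ x hx
    have hqp := hQ q (mem_insert_self _ _)
    have hQ' : ∀ p ∈ Q, Nat.Prime p := fun p hp => hQ p (mem_insert_of_mem hp)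
    rw [VS_insert _ _ _ _ hqp hq, VS_insert _ _ _ _ hqp hq, prod_insert hq]
    have h1 := ih hQ' x hx
    have h2 := ih hQ' (x / q) (by positivity)
    set E := ∏ p ∈ Q, (1 + 6 / (p : ℝ) ^ 2) with hE
    have hE0 : 0 ≤ E := prod_nonneg fun _ _ => by positivity
    set R := VS Q (fun p => 1 / (p : ℝ)) x with hR
    set R' := VS Q (fun p => 1 / (p : ℝ)) (x / q) with hR'
    have hR0 : 0 ≤ R' := VS_nonneg _ _ (fun _ => by positivity) _
    have hRR : R' ≤ R := VS_mono _ _ (fun _ => by positivity)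
      (div_le_self hx (by exact_mod_cast hqp.one_lt.le))
    have hv := v_le hqp
    have hv0 := v_nonneg q
    set b : ℝ := 1 / (q : ℝ) with hb
    have hb0 : 0 ≤ b := by positivity
    have e6 : 6 / (q : ℝ) ^ 2 = 6 * b ^ 2 := by rw [hb]; ring
    rw [e6] at hv ⊢
    calc VS Q v x + v q * VS Q v (x / q) ≤ E * R + v q * (E * R') :=
          add_le_add h1 (mul_le_mul_of_nonneg_left h2 hv0)
      _ ≤ E * R + (b + 6 * b ^ 2) * (E * R') := by
          gcongr
      _ ≤ (1 + 6 * b ^ 2) * E * (R + b * R') := by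
          have : 0 ≤ E * (6 * b ^ 2) * (R - R') := by
            apply mul_nonneg (by positivity); linarith
          have h3 : 0 ≤ E * (6 * b ^ 2) * (b * R') := by positivity
          nlinarith

lemma prod_inj (Q : Finset ℕ) (hQ : ∀ p ∈ Q, Nat.Prime p) (S S' : Finset ℕ) (hS : S ⊆ Q)
    (hS' : S' ⊆ Q) (h : ∏ p ∈ S, p = ∏ p ∈ S', p) : S = S' := by
  have key : ∀ A B : Finset ℕ, A ⊆ Q → B ⊆ Q → ∏ p ∈ A, p = ∏ p ∈ B, p → A ⊆ B := by
    intro A B hA hB h p hp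
    have h1 : p ∣ ∏ p ∈ B, p := h ▸ dvd_prod_of_mem (fun p => p) hp
    rw [(hQ p (hA hp)).prime.dvd_finsetProd_iff] at h1
    obtain ⟨a, ha, h⟩ := h1
    rw [Nat.prime_dvd_prime_iff_eq (hQ p (hA hp)) (hQ a (hB ha))] at h
    exact h ▸ ha
  exact Subset.antisymm (key _ _ hS hS' h) (key _ _ hS' hS h.symm)

lemma VS_harm (Q : Finset ℕ) (hQ : ∀ p ∈ Q, Nat.Prime p) (Y : ℝ) (hY : 1 ≤ Y) :
    VS Q (fun p => 1 / (p : ℝ)) Y ≤ 1 + Real.log Y := by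
  have h1 : VS Q (fun p => 1 / (p : ℝ)) Y ≤ ∑ k ∈ Icc 1 ⌊Y⌋₊, 1 / (k : ℝ) := by
    unfold VS
    set A := Q.powerset.filter (fun S => ((∏ p ∈ S, p : ℕ) : ℝ) ≤ Y) with hA
    have hinj : Set.InjOn (fun S : Finset ℕ => ∏ p ∈ S, p) A := by
      intro S hS S' hS' h
      simp only [hA, coe_filter, mem_powerset, Set.mem_ofPred_eq] at hS hS'
      exact prod_inj Q hQ S S' hS.1 hS'.1 h
    calc ∑ S ∈ A, ∏ p ∈ S, 1 / (p : ℝ) = ∑ S ∈ A, 1 / ((∏ p ∈ S, p : ℕ) : ℝ) := by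
          refine sum_congr rfl fun S _ => ?_
          rw [prod_div_distrib]; push_cast; simp
      _ = ∑ k ∈ A.image (fun S : Finset ℕ => ∏ p ∈ S, p), 1 / (k : ℝ) := by
          rw [sum_image hinj]
      _ ≤ _ := by
          refine sum_le_sum_of_subset_of_nonneg ?_ (fun _ _ _ => by positivity)
          intro k hk
          rw [mem_image] at hk
          obtain ⟨S, hS, rfl⟩ := hk
          simp only [hA, mem_filter, mem_powerset] at hS
          rw [mem_Icc]
          exact ⟨prod_pos fun p hp => (hQ p (hS.1 hp)).pos, Nat.le_floor hS.2⟩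
  refine h1.trans ?_
  have := harmonic_floor_le_one_add_log Y hY
  rw [harmonic_eq_sum_Icc] at this
  push_cast at this
  simpa [one_div] using this

lemma VS_v (Q : Finset ℕ) (hQ : ∀ p ∈ Q, Nat.Prime p) (Y : ℝ) (hY : 1 ≤ Y) :
    VS Q v Y ≤ Real.exp 6 * (1 + Real.log Y) := by
  refine (VS_le Q hQ Y (by linarith)).trans ?_
  refine mul_le_mul (prod_six Q hQ) (VS_harm Q hQ Y hY) (VS_nonneg _ _ (fun _ => by positivity) _)
    (Real.exp_pos _).le

lemma VS_mul (N P : Finset ℕ) (hN : ∀ p ∈ N, Nat.Prime p)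
    (hd : Disjoint N P) (x X : ℝ) (hX : 0 ≤ X) :
    VS N (fun p => 1 / (p : ℝ)) X * VS P v x ≤ VS (N ∪ P) v (X * x) := by
  unfold VS
  rw [sum_mul_sum, ← sum_product']
  set A := (N.powerset.filter (fun S => ((∏ p ∈ S, p : ℕ) : ℝ) ≤ X)) ×ˢ
    (P.powerset.filter (fun S => ((∏ p ∈ S, p : ℕ) : ℝ) ≤ x)) with hA
  have hmem : ∀ z ∈ A, z.1 ⊆ N ∧ z.2 ⊆ P ∧ ((∏ p ∈ z.1, p : ℕ) : ℝ) ≤ X ∧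
      ((∏ p ∈ z.2, p : ℕ) : ℝ) ≤ x := by
    intro z hz
    simp only [hA, mem_product, mem_filter, mem_powerset] at hz
    tauto
  have hinj : Set.InjOn (fun z : Finset ℕ × Finset ℕ => z.1 ∪ z.2) A := by
    intro z hz w hw h
    obtain ⟨z1, z2, _, _⟩ := hmem z hz
    obtain ⟨w1, w2, _, _⟩ := hmem w hw
    have h' : ∀ a, (a ∈ z.1 ∨ a ∈ z.2) ↔ (a ∈ w.1 ∨ a ∈ w.2) := by
      intro a
      have := congrArg (fun s => a ∈ s) h
      simpa using this
    rw [Finset.disjoint_left] at hd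
    refine Prod.ext ?_ ?_ <;> ext a <;>
    · have := h' a
      have i1 := @z1 a
      have i2 := @z2 a
      have i3 := @w1 a
      have i4 := @w2 a
      have i5 := @hd a
      tauto
  calc _ ≤ ∑ z ∈ A, ∏ p ∈ z.1 ∪ z.2, v p := by
        refine sum_le_sum fun z hz => ?_
        obtain ⟨z1, z2, _, _⟩ := hmem z hz
        rw [prod_union (disjoint_of_subset_left z1 (disjoint_of_subset_right z2 hd))]
        refine mul_le_mul_of_nonneg_right ?_ (prod_nonneg fun p _ => v_nonneg p)
        exact prod_le_prod (fun _ _ => by positivity) fun p hp => v_ge (hN p (z1 hp))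
    _ = ∑ S ∈ A.image (fun z : Finset ℕ × Finset ℕ => z.1 ∪ z.2), ∏ p ∈ S, v p := by
        rw [sum_image hinj]
    _ ≤ _ := by
        refine sum_le_sum_of_subset_of_nonneg ?_ (fun _ _ _ => prod_nonneg fun p _ => v_nonneg p)
        intro S hS
        rw [mem_image] at hS
        obtain ⟨z, hz, rfl⟩ := hS
        obtain ⟨z1, z2, z3, z4⟩ := hmem z hz
        simp only [mem_filter, mem_powerset]
        refine ⟨union_subset_union z1 z2, ?_⟩
        rw [prod_union (disjoint_of_subset_left z1 (disjoint_of_subset_right z2 hd))]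
        push_cast at *
        exact mul_le_mul z3 z4 (by positivity) hX

lemma VS_low (N : Finset ℕ) (hN : ∀ p ∈ N, Nat.Prime p) (X : ℝ) (hX : 2 ^ (N.card + 1) ≤ X) :
    1 / 2 * ∏ p ∈ N, (1 + 1 / (p : ℝ)) ≤ VS N (fun p => 1 / (p : ℝ)) X := by
  have hX0 : 0 < X := lt_of_lt_of_le (by positivity) hX
  have h1 : ∏ p ∈ N, (1 + 1 / (p : ℝ)) = ∑ S ∈ N.powerset, ∏ p ∈ S, 1 / (p : ℝ) := by
    rw [prod_one_add]
  have h2 : ∑ S ∈ N.powerset, ∏ p ∈ S, 1 / (p : ℝ) ≤ VS N (fun p => 1 / (p : ℝ)) X + 2 ^ N.card / X := by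
    unfold VS
    rw [sum_filter]
    have : (2 : ℝ) ^ N.card / X = ∑ S ∈ N.powerset, 1 / X := by
      rw [sum_const, card_powerset, nsmul_eq_mul]; push_cast; ring
    rw [this, ← sum_add_distrib]
    refine sum_le_sum fun S hS => ?_
    split_ifs with h
    · have : 0 < 1 / X := by positivity
      linarith
    · rw [zero_add, prod_div_distrib, prod_const_one]
      push_cast at h
      exact one_div_le_one_div_of_le hX0 (by linarith)
  have h3 : (2 : ℝ) ^ N.card / X ≤ 1 / 2 := by
    rw [div_le_iff₀ hX0]
    rw [pow_succ] at hX
    linarith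
  have h4 : 1 ≤ ∏ p ∈ N, (1 + 1 / (p : ℝ)) := by
    exact Finset.prod_induction _ (fun x : ℝ => 1 ≤ x) (fun a b ha hb => by nlinarith) le_rfl
      (fun p _ => by have : 0 ≤ 1 / (p : ℝ) := by positivity
                     linarith)
  rw [← h1] at h2
  linarith

theorem T_bound : ∃ C : ℝ, 0 < C ∧ ∀ N P : Finset ℕ, (∀ p ∈ N, Nat.Prime p) →
    (∀ p ∈ P, Nat.Prime p) → Disjoint N P → ∀ D : ℝ, 1 / 2 ≤ D → ∀ x : ℝ, 0 ≤ x → x ≤ 2 * D →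
    T N P x ≤ al N * x + C * 2 ^ N.card * al N * Real.log (4 * D) := by
  set C1 : ℝ := 12 * Real.exp 2 * Real.exp 6 with hC1
  refine ⟨C1 + 10, by positivity, ?_⟩
  intro N P hN hP hd D hD x hx hxD
  have hal := al_pos N hN
  have hlog : 1 / 2 ≤ Real.log (4 * D) := by
    have : Real.log 2 ≤ Real.log (4 * D) := Real.log_le_log two_pos (by linarith)
    linarith [Real.log_two_gt_d9]
  have h2p : (0 : ℝ) < 2 ^ N.card := by positivity
  by_cases hcase : (2 : ℝ) ^ (N.card + 1) ≤ (4 * D) ^ 3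
  · have h1 := T_le N P hN hP hd x hx
    suffices h : VS P v x ≤ C1 * al N * Real.log (4 * D) by
      have h3 := mul_le_mul_of_nonneg_left h h2p.le
      have : 0 ≤ 10 * 2 ^ N.card * al N * Real.log (4 * D) := by positivity
      nlinarith
    have a1 : VS P v x ≤ VS P v (4 * D) := VS_mono _ _ v_nonneg (by linarith)
    have a2 := VS_mul N P hN hd (4 * D) ((4 * D) ^ 3) (by positivity)
    have a3 := VS_v (N ∪ P) (fun p hp => (mem_union.1 hp).elim (hN p) (hP p)) ((4 * D) ^ 3 * (4 * D))
      (by rw [← pow_succ]; exact one_le_pow₀ (by linarith))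
    have a4 := VS_low N hN _ hcase
    have a5 := al_sig N hN
    have a6 : Real.log ((4 * D) ^ 3 * (4 * D)) = 4 * Real.log (4 * D) := by
      rw [← pow_succ, Real.log_pow]; norm_num
    rw [a6] at a3
    have hV0 : 0 ≤ VS P v (4 * D) := VS_nonneg _ _ v_nonneg _
    have a7 : (1 / 2 * ∏ p ∈ N, (1 + 1 / (p : ℝ))) * VS P v (4 * D) ≤ Real.exp 6 * (6 * Real.log (4 * D)) := by
      refine (mul_le_mul_of_nonneg_right a4 hV0).trans (a2.trans (a3.trans ?_))
      refine mul_le_mul_of_nonneg_left ?_ (Real.exp_pos _).le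
      linarith
    have a8 := mul_le_mul_of_nonneg_right a5 hV0
    have a9 := mul_le_mul_of_nonneg_left a7 hal.le
    have a10 : Real.exp (-2) * VS P v (4 * D) ≤ 12 * Real.exp 6 * al N * Real.log (4 * D) := by
      nlinarith
    have a11 := mul_le_mul_of_nonneg_left a10 (Real.exp_pos 2).le
    rw [← mul_assoc, ← Real.exp_add] at a11
    norm_num at a11
    refine a1.trans (a11.trans (le_of_eq ?_))
    rw [hC1]; ring
  · push Not at hcase
    have h1 := T_le_triv N P hN hP hd x hx
    have h2 := al_low N hN
    have h3 : 4 * D ≤ 2 * (4 / 3 : ℝ) ^ N.card := by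
      refine le_of_pow_le_pow_left₀ (n := 3) (by norm_num) (by positivity) ?_
      refine hcase.le.trans ?_
      rw [mul_pow, ← pow_mul, mul_comm N.card 3, pow_mul, pow_succ]
      have : (2 : ℝ) ^ N.card ≤ ((4 / 3) ^ 3) ^ N.card := pow_le_pow_left₀ (by norm_num) (by norm_num) _
      have h0 : (0 : ℝ) < ((4 / 3) ^ 3) ^ N.card := by positivity
      linarith
    have h4 : (4 / 3 : ℝ) ^ N.card = 2 ^ N.card * (2 / 3) ^ N.card := by
      rw [← mul_pow]; norm_num
    have h5 : 3 / 4 * (4 / 3 : ℝ) ^ N.card ≤ 2 ^ N.card * al N := by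
      rw [h4]; nlinarith
    have h6 : x ≤ 10 * 2 ^ N.card * al N * Real.log (4 * D) := by
      have : 0 < 2 ^ N.card * al N := by positivity
      nlinarith
    have h7 : 0 ≤ al N * x := by positivity
    have h8 : 0 ≤ C1 * 2 ^ N.card * al N * Real.log (4 * D) := by positivity
    linarith
end OE

namespace OE
open Finset

lemma per_card (M : ℕ) (Q : ℕ → Prop) [DecidablePred Q] (hQ : Function.Periodic Q M) (h : ℕ) :
    ((range (h * M)).filter Q).card = h * ((range M).filter Q).card := by
  induction h with
  | zero => simp
  | succ h ih =>
    rw [add_mul, one_mul, range_eq_Ico, ← Ico_union_Ico_eq_Ico (Nat.zero_le (h * M)) (Nat.le_add_right _ M),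
      filter_union, card_union_of_disjoint, ← range_eq_Ico, ih,
      Nat.filter_Ico_card_eq_of_periodic _ _ _ hQ, Nat.count_eq_card_filter_range]
    · ring
    · exact disjoint_filter_filter (Ico_disjoint_Ico_consecutive _ _ _)

lemma crt_card (P : Finset ℕ) (hP : ∀ p ∈ P, Nat.Prime p) (G : (p : ℕ) → ZMod p → Prop)
    [DecidablePred (fun k : ℕ => ∀ p ∈ P, G p (k : ZMod p))] :
    ((range (∏ p ∈ P, p)).filter (fun k => ∀ p ∈ P, G p (k : ZMod p))).card ≤
      ∏ p ∈ P, Nat.card {x : ZMod p // G p x} := by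
  have h1 : ∏ p ∈ P, Nat.card {x : ZMod p // G p x} = ∏ p : P, Nat.card {x : ZMod p // G p x} :=
    (prod_coe_sort P (fun p => Nat.card {x : ZMod p // G p x})).symm
  rw [h1, ← Nat.card_pi, ← Nat.card_eq_finsetCard]
  have hfin : ∀ p : P, Finite (ZMod p) := fun p => by
    have : NeZero (p : ℕ) := ⟨(hP _ p.2).ne_zero⟩
    infer_instance
  refine Nat.card_le_card_of_injective
    (fun k (p : P) => ⟨((k : ℕ) : ZMod p), (mem_filter.1 k.2).2 p p.2⟩) ?_
  intro k k' h
  have h2 : ∀ p ∈ P, (p : ℤ) ∣ ((k' : ℕ) : ℤ) - ((k : ℕ) : ℤ) := by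
    intro p hp
    have := congrFun h ⟨p, hp⟩
    simp only [Subtype.mk.injEq] at this
    rw [ZMod.natCast_eq_natCast_iff] at this
    exact (Nat.modEq_iff_dvd).1 this
  have h3 : ((∏ p ∈ P, p : ℕ) : ℤ) ∣ ((k' : ℕ) : ℤ) - ((k : ℕ) : ℤ) := by
    rw [Int.natCast_dvd]
    rw [← prod_dvd_iff P hP]
    intro p hp
    exact Int.natCast_dvd.1 (h2 p hp)
  have h4 := (Nat.modEq_iff_dvd).2 h3
  have k1 := mem_range.1 (mem_filter.1 k.2).1
  have k2 := mem_range.1 (mem_filter.1 k'.2).1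
  exact Subtype.ext (Nat.ModEq.eq_of_lt_of_lt h4 k1 k2)

lemma card_one (p : ℕ) [Fact p.Prime] (G : ZMod p → Prop) (x : ZMod p) (hx : ¬ G x) :
    (Nat.card {x : ZMod p // G x} : ℝ) ≤ p - 1 := by
  classical
  rw [Nat.card_eq_fintype_card, Fintype.card_subtype]
  have : (univ.filter G) ⊆ univ.erase x := by
    intro y hy
    rw [mem_erase]
    refine ⟨fun h => hx (h ▸ (mem_filter.1 hy).2), mem_univ _⟩
  have h := card_le_card this
  rw [card_erase_of_mem (mem_univ _), card_univ, ZMod.card] at h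
  have hp := (Fact.out : p.Prime).pos
  have : ((univ.filter G).card : ℝ) + 1 ≤ p := by
    exact_mod_cast (by omega : (univ.filter G).card + 1 ≤ p)
  linarith

lemma card_two (p : ℕ) [Fact p.Prime] (G : ZMod p → Prop) (x y : ZMod p) (hx : ¬ G x) (hy : ¬ G y)
    (hxy : x ≠ y) :
    (Nat.card {x : ZMod p // G x} : ℝ) ≤ p - 2 := by
  classical
  rw [Nat.card_eq_fintype_card, Fintype.card_subtype]
  have : (univ.filter G) ⊆ (univ.erase x).erase y := by
    intro z hz
    rw [mem_erase, mem_erase]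
    have := (mem_filter.1 hz).2
    exact ⟨fun h => hy (h ▸ this), fun h => hx (h ▸ this), mem_univ _⟩
  have h := card_le_card this
  rw [card_erase_of_mem (mem_erase.2 ⟨hxy.symm, mem_univ _⟩), card_erase_of_mem (mem_univ _), card_univ, ZMod.card] at h
  have hp := (Fact.out : p.Prime).two_le
  have : ((univ.filter G).card : ℝ) + 2 ≤ p := by
    exact_mod_cast (by omega : (univ.filter G).card + 2 ≤ p)
  linarith

def Gd (a b : ℤ) (q r : ℕ) (p : ℕ) (x : ZMod p) : Prop :=
  (a : ZMod p) + x * q ≠ 0 ∧ (b : ZMod p) + x * r ≠ 0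

noncomputable def kap (n c p : ℕ) : ℝ :=
  if p ∣ n then 1 - 1 / (p : ℝ) else (1 - 1 / (p : ℝ)) ^ 2 * ((if p ∣ c then v p else 0) + u p)

lemma card_loc (a b : ℤ) (q r : ℕ) (hqr : q.Coprime r) (p : ℕ) (hp : p.Prime) :
    (Nat.card {x : ZMod p // Gd a b q r p x} : ℝ) ≤ p * kap (q * r) (a * r - b * q).natAbs p := by
  have : Fact p.Prime := ⟨hp⟩
  have h2 := two_le hp
  have hp0 : (p : ℝ) ≠ 0 := by intro h; linarith
  have hp1 : (p : ℝ) - 1 ≠ 0 := by intro h; linarith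
  have hdq : (q : ZMod p) = 0 ↔ p ∣ q := ZMod.natCast_eq_zero_iff q p
  have hdr : (r : ZMod p) = 0 ↔ p ∣ r := ZMod.natCast_eq_zero_iff r p
  have rootq : ¬ p ∣ q → ¬ Gd a b q r p (-(a : ZMod p) / q) := by
    intro h hG
    apply hG.1
    have : (q : ZMod p) ≠ 0 := fun h' => h (hdq.1 h')
    field_simp
    ring
  have rootr : ¬ p ∣ r → ¬ Gd a b q r p (-(b : ZMod p) / r) := by
    intro h hG
    apply hG.2
    have : (r : ZMod p) ≠ 0 := fun h' => h (hdr.1 h')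
    field_simp
    ring
  have hone : (p : ℝ) * (1 - 1 / (p : ℝ)) = p - 1 := by field_simp
  unfold kap
  split_ifs with h h'
  · rw [hone]
    by_cases hq : p ∣ q
    · have hr : ¬ p ∣ r := fun hr => by
        have := Nat.dvd_gcd hq hr
        rw [hqr] at this
        exact hp.one_lt.ne' (Nat.dvd_one.1 this)
      exact card_one p _ _ (rootr hr)
    · exact card_one p _ _ (rootq hq)
  · have hq : ¬ p ∣ q := fun hq => h (hq.mul_right r)
    refine (card_one p _ _ (rootq hq)).trans (le_of_eq ?_)
    unfold u v
    field_simp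
    ring
  · have hq : ¬ p ∣ q := fun hq => h (hq.mul_right r)
    have hr : ¬ p ∣ r := fun hr => h (hr.mul_left q)
    refine (card_two p _ _ _ (rootq hq) (rootr hr) ?_).trans (le_of_eq ?_)
    · intro he
      apply h'
      have hq' : (q : ZMod p) ≠ 0 := fun h' => hq (hdq.1 h')
      have hr' : (r : ZMod p) ≠ 0 := fun h' => hr (hdr.1 h')
      rw [div_eq_div_iff hq' hr'] at he
      rw [← Int.natCast_dvd, ← ZMod.intCast_zmod_eq_zero_iff_dvd]
      push_cast
      linear_combination -he
    · unfold u
      field_simp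
      ring

lemma N_count (g q r : ℕ) (hg : 0 < g) (hqr : q.Coprime r) (a b : ℤ)
    [DecidablePred (fun k : ℕ => ∀ p ∈ g.primeFactors, Gd a b q r p (k : ZMod p))] :
    (((range g).filter (fun k : ℕ => ∀ p ∈ g.primeFactors, Gd a b q r p (k : ZMod p))).card : ℝ) ≤
      g * ∏ p ∈ g.primeFactors, kap (q * r) (a * r - b * q).natAbs p := by
  have hpr : ∀ p ∈ g.primeFactors, p.Prime := fun p hp => Nat.prime_of_mem_primeFactors hp
  obtain ⟨h, hh⟩ := Nat.prod_primeFactors_dvd g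
  have hper : Function.Periodic (fun k : ℕ => ∀ p ∈ g.primeFactors, Gd a b q r p (k : ZMod p))
      (∏ p ∈ g.primeFactors, p) := by
    intro k
    refine propext (forall₂_congr fun p hp => ?_)
    have : ((k + ∏ p ∈ g.primeFactors, p : ℕ) : ZMod p) = k := by
      have : ((∏ p ∈ g.primeFactors, p : ℕ) : ZMod p) = 0 :=
        (ZMod.natCast_eq_zero_iff _ p).2 (dvd_prod_of_mem (fun p => p) hp)
      rw [Nat.cast_add, this, add_zero]
    rw [this]
  have h1 := per_card _ _ hper h
  rw [mul_comm h, ← hh] at h1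
  rw [h1]
  have h2 := crt_card g.primeFactors hpr (Gd a b q r)
  have h3 : ((∏ p ∈ g.primeFactors, Nat.card {x : ZMod p // Gd a b q r p x} : ℕ) : ℝ) ≤
      ∏ p ∈ g.primeFactors, ((p : ℝ) * kap (q * r) (a * r - b * q).natAbs p) := by
    push_cast
    exact prod_le_prod (fun _ _ => by positivity) fun p hp => card_loc a b q r hqr p (hpr p hp)
  rw [prod_mul_distrib] at h3
  have h4 : (((range (∏ p ∈ g.primeFactors, p)).filter (fun k : ℕ => ∀ p ∈ g.primeFactors, Gd a b q r p (k : ZMod p))).card : ℝ) ≤ _ := (Nat.cast_le.2 h2).trans h3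
  have h5 : (g : ℝ) = (∏ p ∈ g.primeFactors, (p : ℝ)) * h := by
    have := congrArg (Nat.cast : ℕ → ℝ) hh
    rwa [Nat.cast_mul, Nat.cast_prod] at this
  rw [Nat.cast_mul]
  refine (mul_le_mul_of_nonneg_left h4 (Nat.cast_nonneg h)).trans (le_of_eq ?_)
  conv_rhs => rw [h5]
  ring
end OE

namespace OE
open Finset MeasureTheory

lemma per_vol (K : Set ℝ) (hK : MeasurableSet K) (s : ℝ) :
    volume {x : ℝ | x ∈ Set.Icc (0 : ℝ) 1 ∧ ∃ j : ℤ, x - s - j ∈ K} ≤ volume K := by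
  have h1 : {x : ℝ | x ∈ Set.Icc (0 : ℝ) 1 ∧ ∃ j : ℤ, x - s - j ∈ K} ⊆
      {0} ∪ ⋃ j : ℤ, (fun x => x + (-s + j)) ⁻¹' (K ∩ Set.Ioc (-s + j) (-s + j + 1)) := by
    rintro x ⟨⟨hx0, hx1⟩, j, hj⟩
    rcases hx0.eq_or_lt with h | h
    · left; exact h.symm
    · right
      rw [Set.mem_iUnion]
      refine ⟨-j, ?_, ?_, ?_⟩
      · have : x + (-s + ((-j : ℤ) : ℝ)) = x - s - j := by push_cast; ring
        change x + (-s + ((-j : ℤ) : ℝ)) ∈ K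
        rwa [this]
      · simpa using h
      · change x + (-s + ((-j : ℤ) : ℝ)) ≤ _
        linarith
  refine (measure_mono h1).trans ((measure_union_le _ _).trans ?_)
  rw [Real.volume_singleton, zero_add]
  refine (measure_iUnion_le _).trans ?_
  simp_rw [measure_preimage_add_right]
  rw [← measure_iUnion]
  · exact measure_mono (Set.iUnion_subset fun _ => Set.inter_subset_left)
  · intro i j hij
    exact (Set.pairwise_disjoint_Ioc_add_intCast (-s) hij).mono Set.inter_subset_right Set.inter_subset_right
  · intro j
    exact hK.inter measurableSet_Ioc

lemma vol_K (x y δ Δ : ℝ) :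
    volume (Set.Ioo (x - δ) (x + δ) ∩ Set.Ioo (y - Δ) (y + Δ)) ≤
      ENNReal.ofReal (max 0 (min (2 * min δ Δ) (δ + Δ - |x - y|))) := by
  rw [Set.Ioo_inter_Ioo, Real.volume_Ioo]
  apply ENNReal.ofReal_le_ofReal
  refine le_max_of_le_right ?_
  have a1 := min_le_left (x + δ) (y + Δ)
  have a2 := min_le_right (x + δ) (y + Δ)
  have a3 := le_max_left (x - δ) (y - Δ)
  have a4 := le_max_right (x - δ) (y - Δ)
  refine le_min ?_ ?_
  · rcases min_choice δ Δ with h | h <;> rw [h] <;> linarith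
  · rcases abs_choice (x - y) with h | h <;> rw [h] <;> linarith

noncomputable def ww (δ Δ y : ℝ) : ℝ := max 0 (min (2 * min δ Δ) (δ + Δ - y))

/-- the piece of the intersection with given `c` -/
def Uset (g q r : ℕ) (δ Δ : ℝ) (c : ℤ) : Set ℝ :=
  {x : ℝ | x ∈ Set.Icc (0 : ℝ) 1 ∧ ∃ a b : ℤ, Int.gcd a ((g * q : ℕ) : ℤ) = 1 ∧
    Int.gcd b ((g * r : ℕ) : ℤ) = 1 ∧ a * r - b * q = c ∧
    |x - (a : ℝ) / ((g * q : ℕ) : ℝ)| < δ ∧ |x - (b : ℝ) / ((g * r : ℕ) : ℝ)| < Δ}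

lemma ne_zero_of_gcd (p : ℕ) (hp : p.Prime) (a : ℤ) (Q : ℕ) (h : Int.gcd a (Q : ℤ) = 1) (hpQ : p ∣ Q) :
    (a : ZMod p) ≠ 0 := by
  intro h0
  rw [ZMod.intCast_zmod_eq_zero_iff_dvd] at h0
  have : p ∣ Int.gcd a (Q : ℤ) := by
    have h2 : (p : ℤ) ∣ (Q : ℤ) := by exact_mod_cast hpQ
    exact Int.natCast_dvd_natCast.1 (Int.dvd_coe_gcd h0 h2)
  rw [h] at this
  exact hp.one_lt.ne' (Nat.dvd_one.1 this)

lemma vol_U (g q r : ℕ) (hg : 0 < g) (hq : 0 < q) (hr : 0 < r) (hqr : q.Coprime r) (δ Δ : ℝ) (c : ℤ) :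
    volume (Uset g q r δ Δ c) ≤ ENNReal.ofReal ((g * ∏ p ∈ g.primeFactors, kap (q * r) c.natAbs p) *
      ww δ Δ (c.natAbs / ((g * q * r : ℕ) : ℝ))) := by
  classical
  rcases (Uset g q r δ Δ c).eq_empty_or_nonempty with h | ⟨_, _, a, b, _, _, hab, _, _⟩
  · rw [h]; simp
  set K := Set.Ioo ((a : ℝ) / ((g * q : ℕ) : ℝ) - δ) ((a : ℝ) / ((g * q : ℕ) : ℝ) + δ) ∩
    Set.Ioo ((b : ℝ) / ((g * r : ℕ) : ℝ) - Δ) ((b : ℝ) / ((g * r : ℕ) : ℝ) + Δ) with hK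
  have hKm : MeasurableSet K := measurableSet_Ioo.inter measurableSet_Ioo
  set A := (range g).filter (fun k : ℕ => ∀ p ∈ g.primeFactors, Gd a b q r p (k : ZMod p)) with hA
  have hg' : (g : ℝ) ≠ 0 := by exact_mod_cast hg.ne'
  have hq' : (q : ℝ) ≠ 0 := by exact_mod_cast hq.ne'
  have hr' : (r : ℝ) ≠ 0 := by exact_mod_cast hr.ne'
  have hsub : Uset g q r δ Δ c ⊆ ⋃ k ∈ A, {x : ℝ | x ∈ Set.Icc (0 : ℝ) 1 ∧ ∃ j : ℤ, x - (k : ℝ) / g - j ∈ K} := by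
    rintro x ⟨hx, a', b', ha', hb', hab', h1, h2⟩
    have hk : (q : ℤ) ∣ a' - a := by
      have : (q : ℤ) ∣ (a' - a) * r := ⟨b' - b, by linear_combination hab' - hab⟩
      exact (Int.isCoprime_iff_gcd_eq_one.2 (by simpa using hqr)).dvd_of_dvd_mul_right this
    obtain ⟨k, hk⟩ := hk
    have hk2 : b' - b = r * k := by
      have : (q : ℤ) * (b' - b) = q * (r * k) := by linear_combination hab - hab' + r * hk
      exact mul_left_cancel₀ (by exact_mod_cast hq.ne') this
    have hgz : (0 : ℤ) < g := by exact_mod_cast hg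
    obtain ⟨k0, hk0⟩ := Int.eq_ofNat_of_zero_le (Int.emod_nonneg k hgz.ne')
    have hk0lt : k0 < g := by
      have := Int.emod_lt_of_pos k hgz
      rw [hk0] at this; exact_mod_cast this
    have hkd := Int.emod_add_mul_ediv k g
    rw [hk0] at hkd
    set j := k / (g : ℤ)
    have hkr : (k : ℝ) = k0 + g * j := by
      rw [← hkd]; push_cast; ring
    simp only [Set.mem_iUnion]
    refine ⟨k0, ?_, hx, j, ?_⟩
    · rw [hA, mem_filter, mem_range]
      refine ⟨hk0lt, fun p hp => ?_⟩
      have hpp := Nat.prime_of_mem_primeFactors hp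
      have hpg := Nat.dvd_of_mem_primeFactors hp
      have hkz : (k : ZMod p) = k0 := by
        rw [← hkd]; push_cast
        rw [(ZMod.natCast_eq_zero_iff g p).2 hpg]; ring
      constructor
      · have := ne_zero_of_gcd p hpp a' _ ha' (hpg.mul_right q)
        rw [show a' = a + q * k by linarith] at this
        push_cast at this
        rwa [hkz, mul_comm (q : ZMod p)] at this
      · have := ne_zero_of_gcd p hpp b' _ hb' (hpg.mul_right r)
        rw [show b' = b + r * k by linarith] at this
        push_cast at this
        rwa [hkz, mul_comm (r : ZMod p)] at this
    · have e1 : (a' : ℝ) = a + q * k := by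
        exact_mod_cast (by linarith : a' = a + q * k)
      have e2 : (b' : ℝ) = b + r * k := by
        exact_mod_cast (by linarith : b' = b + r * k)
      have f1 : (a' : ℝ) / ((g * q : ℕ) : ℝ) = (a : ℝ) / ((g * q : ℕ) : ℝ) + (k0 : ℝ) / g + j := by
        rw [e1, hkr]; push_cast; field_simp; ring
      have f2 : (b' : ℝ) / ((g * r : ℕ) : ℝ) = (b : ℝ) / ((g * r : ℕ) : ℝ) + (k0 : ℝ) / g + j := by
        rw [e2, hkr]; push_cast; field_simp; ring
      rw [f1, abs_lt] at h1
      rw [f2, abs_lt] at h2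
      refine ⟨⟨?_, ?_⟩, ⟨?_, ?_⟩⟩ <;> linarith [h1.1, h1.2, h2.1, h2.2]
  have hv : volume K ≤ ENNReal.ofReal (ww δ Δ (c.natAbs / ((g * q * r : ℕ) : ℝ))) := by
    refine (vol_K _ _ _ _).trans (le_of_eq ?_)
    unfold ww
    have : |(a : ℝ) / ((g * q : ℕ) : ℝ) - (b : ℝ) / ((g * r : ℕ) : ℝ)| = c.natAbs / ((g * q * r : ℕ) : ℝ) := by
      have e : (a : ℝ) / ((g * q : ℕ) : ℝ) - (b : ℝ) / ((g * r : ℕ) : ℝ) = (c : ℝ) / ((g * q * r : ℕ) : ℝ) := by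
        rw [← hab]; push_cast; field_simp
      rw [e, abs_div, Nat.abs_cast, Nat.cast_natAbs, Int.cast_abs]
    rw [this]
  calc volume (Uset g q r δ Δ c) ≤ ∑ k ∈ A, volume {x : ℝ | x ∈ Set.Icc (0 : ℝ) 1 ∧ ∃ j : ℤ, x - (k : ℝ) / g - j ∈ K} :=
        (measure_mono hsub).trans (measure_biUnion_finset_le _ _)
    _ ≤ ∑ k ∈ A, volume K := sum_le_sum fun k _ => per_vol K hKm _
    _ = A.card * volume K := by rw [sum_const, nsmul_eq_mul]
    _ ≤ ENNReal.ofReal (A.card) * ENNReal.ofReal (ww δ Δ (c.natAbs / ((g * q * r : ℕ) : ℝ))) := by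
        rw [ENNReal.ofReal_natCast]; gcongr
    _ = ENNReal.ofReal (A.card * ww δ Δ (c.natAbs / ((g * q * r : ℕ) : ℝ))) := by
        rw [ENNReal.ofReal_mul (Nat.cast_nonneg _)]
    _ ≤ _ := by
        apply ENNReal.ofReal_le_ofReal
        refine mul_le_mul_of_nonneg_right ?_ (le_max_left _ _)
        have := N_count g q r hg hqr a b
        rw [hab] at this
        exact this
end OE

namespace OE
open Finset MeasureTheory

lemma ww_int (δ Δ y : ℝ) (h0 : 0 ≤ min δ Δ) :
    ww δ Δ y = ∫ s in (0 : ℝ)..(2 * min δ Δ), (Set.Iic (δ + Δ - y)).indicator (fun _ => (1 : ℝ)) s := by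
  rw [intervalIntegral.integral_of_le (by linarith), integral_indicator measurableSet_Iic]
  rw [Measure.restrict_restrict measurableSet_Iic, integral_const]
  simp only [smul_eq_mul, mul_one, measureReal_restrict_apply_univ]
  rw [Set.inter_comm, Set.Ioc_inter_Iic, Real.volume_real_Ioc, sub_zero, max_comm]
  rfl

lemma layer (δ Δ ℓ : ℝ) (hδ : 0 ≤ δ) (hΔ : 0 ≤ Δ) (hℓ : 0 < ℓ) (I : Finset ℕ) (co : ℕ → ℝ)
    (A B : ℝ)
    (H : ∀ x : ℝ, 0 ≤ x → x ≤ 2 * (ℓ * max δ Δ) → ∑ c ∈ I.filter (fun c : ℕ => (c : ℝ) ≤ x), co c ≤ A * x + B) :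
    ∑ c ∈ I, co c * ww δ Δ (c / ℓ) ≤ 2 * min δ Δ * (A * (ℓ * max δ Δ) + B) := by
  have h0 : 0 ≤ min δ Δ := le_min hδ hΔ
  have hsum := min_add_max δ Δ
  have hle : min δ Δ ≤ max δ Δ := min_le_max
  have hind : ∀ z : ℝ, IntervalIntegrable ((Set.Iic z).indicator (fun _ => (1 : ℝ))) volume 0 (2 * min δ Δ) := by
    intro z
    rw [intervalIntegrable_iff_integrableOn_Ioc_of_le (by linarith)]
    exact (integrable_const (1 : ℝ)).indicator measurableSet_Iic
  calc ∑ c ∈ I, co c * ww δ Δ (c / ℓ)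
      = ∫ s in (0 : ℝ)..(2 * min δ Δ), ∑ c ∈ I, co c * (Set.Iic (δ + Δ - c / ℓ)).indicator (fun _ => (1 : ℝ)) s := by
        rw [intervalIntegral.integral_finsetSum]
        · refine sum_congr rfl fun c _ => ?_
          rw [intervalIntegral.integral_const_mul, ww_int _ _ _ h0]
        · intro c _
          exact (hind _).const_mul _
    _ ≤ ∫ s in (0 : ℝ)..(2 * min δ Δ), (A * (ℓ * (δ + Δ - s)) + B) := by
        refine intervalIntegral.integral_mono_on (by linarith) ?_ ?_ ?_
        · rw [intervalIntegrable_iff_integrableOn_Ioc_of_le (by linarith)]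
          refine integrable_finsetSum I fun c _ => ?_
          exact (intervalIntegrable_iff_integrableOn_Ioc_of_le (by linarith)).1 ((hind (δ + Δ - c / ℓ)).const_mul (co c))
        · apply Continuous.intervalIntegrable; fun_prop
        · intro s hs
          have hx := H (ℓ * (δ + Δ - s)) (mul_nonneg hℓ.le (by linarith [hs.2])) (by
            have : δ + Δ - s ≤ 2 * max δ Δ := by linarith [hs.1]
            nlinarith)
          refine le_trans (le_of_eq ?_) hx
          rw [sum_filter]
          refine sum_congr rfl fun c _ => ?_
          have : (s ∈ Set.Iic (δ + Δ - c / ℓ)) ↔ ((c : ℝ) ≤ ℓ * (δ + Δ - s)) := by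
            rw [Set.mem_Iic, ← div_le_iff₀' hℓ]
            constructor <;> intro h <;> linarith
          by_cases h : (c : ℝ) ≤ ℓ * (δ + Δ - s)
          · rw [Set.indicator_of_mem (this.2 h), if_pos h, mul_one]
          · rw [Set.indicator_of_notMem (fun h' => h (this.1 h')), if_neg h, mul_zero]
    _ = _ := by
        have : ∀ s : ℝ, A * (ℓ * (δ + Δ - s)) + B = (A * ℓ * (δ + Δ) + B) - (A * ℓ) * s := fun s => by ring
        simp_rw [this]
        rw [intervalIntegral.integral_sub (by simp) (by apply Continuous.intervalIntegrable; fun_prop),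
          intervalIntegral.integral_const, intervalIntegral.integral_const_mul, integral_id, ← hsum]
        simp only [smul_eq_mul]
        ring

lemma vol_A (ψ : ℕ → ℝ) (q : ℕ) (hq : 1 ≤ q) (h0 : 0 ≤ ψ q) (h1 : ψ q ≤ 1 / 2) :
    2 * (Nat.totient q : ℝ) * (ψ q / q) ≤ (volume (Aset ψ q)).toReal := by
  have hfin : volume (Aset ψ q) ≠ ⊤ := by
    refine ((measure_mono (t := Set.Icc (0 : ℝ) 1) fun x hx => hx.1).trans_lt ?_).ne
    rw [Real.volume_Icc]; exact ENNReal.ofReal_lt_top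
  rw [← ENNReal.ofReal_le_iff_le_toReal hfin]
  have hq0 : (0 : ℝ) < q := by exact_mod_cast hq
  rcases hq.eq_or_lt with h | h
  · subst h
    simp only [Nat.totient_one, Nat.cast_one, mul_one, div_one]
    have hs : Set.Ico (0 : ℝ) (ψ 1) ∪ Set.Ioc (1 - ψ 1) 1 ⊆ Aset ψ 1 := by
      rintro x (⟨hx0, hx1⟩ | ⟨hx0, hx1⟩)
      · refine ⟨⟨hx0, by linarith⟩, 0, by simp, ?_⟩
        simp only [Nat.cast_one, div_one, Int.cast_zero, sub_zero]
        rw [abs_of_nonneg hx0]; exact hx1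
      · refine ⟨⟨by linarith, hx1⟩, 1, by simp, ?_⟩
        simp only [Nat.cast_one, div_one, Int.cast_one]
        rw [abs_lt]; constructor <;> linarith
    refine le_trans (le_of_eq ?_) (measure_mono hs)
    rw [measure_union _ measurableSet_Ioc, Real.volume_Ico, Real.volume_Ioc, ← ENNReal.ofReal_add]
    · congr 1; ring
    · linarith
    · linarith
    · rw [Set.disjoint_left]
      rintro x ⟨_, hx⟩ ⟨hx', _⟩
      linarith
  · set R := (range q).filter (fun a => q.Coprime a) with hR
    set J : ℕ → Set ℝ := fun a => Set.Ioo ((a : ℝ) / q - ψ q / q) ((a : ℝ) / q + ψ q / q) with hJ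
    have hs : (⋃ a ∈ R, J a) ⊆ Aset ψ q := by
      intro x hx
      simp only [Set.mem_iUnion] at hx
      obtain ⟨a, ha, hx1, hx2⟩ := hx
      rw [hR, mem_filter, mem_range] at ha
      have ha1 : 1 ≤ a := by
        rcases Nat.eq_zero_or_pos a with h' | h'
        · subst h'
          have := ha.2
          rw [Nat.coprime_zero_right] at this
          omega
        · exact h'
      have ha1' : (1 : ℝ) ≤ a := by exact_mod_cast ha1
      have ha2' : (a : ℝ) + 1 ≤ q := by exact_mod_cast ha.1
      refine ⟨⟨?_, ?_⟩, a, ?_, ?_⟩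
      · have : 0 ≤ (a : ℝ) / q - ψ q / q := by rw [← sub_div]; apply div_nonneg <;> linarith
        linarith
      · have : (a : ℝ) / q + ψ q / q ≤ 1 := by rw [← add_div, div_le_one hq0]; linarith
        linarith
      · have := ha.2.symm
        simpa [Int.gcd_natCast_natCast] using this
      · rw [abs_lt]
        constructor
        · push_cast; linarith
        · push_cast; linarith
    refine le_trans (le_of_eq ?_) (measure_mono hs)
    rw [measure_biUnion_finset]
    · have : ∀ a ∈ R, volume (J a) = ENNReal.ofReal (2 * (ψ q / q)) := by
        intro a _
        rw [hJ, Real.volume_Ioo]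
        congr 1; ring
      rw [sum_congr rfl this, sum_const, nsmul_eq_mul, ← ENNReal.ofReal_natCast, ← ENNReal.ofReal_mul (Nat.cast_nonneg _)]
      congr 1
      rw [Nat.totient, ← hR]; ring
    · have key : ∀ a b : ℕ, a < b → Disjoint (J a) (J b) := by
        intro a b hab
        rw [Set.disjoint_left]
        rintro x ⟨_, hx⟩ ⟨hx', _⟩
        have h2 : (a : ℝ) + 1 ≤ b := by exact_mod_cast hab
        have h3 : (b : ℝ) / q - ψ q / q < (a : ℝ) / q + ψ q / q := hx'.trans hx
        rw [← sub_div, ← add_div, div_lt_div_iff_of_pos_right hq0] at h3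
        linarith
      intro a _ b _ hab
      rcases lt_or_gt_of_ne hab with h | h
      · exact key a b h
      · exact (key b a h).symm
    · intro a _
      exact measurableSet_Ioo

lemma tot_al (k : ℕ) : (Nat.totient k : ℝ) = k * al k.primeFactors := by
  have := Nat.totient_eq_mul_prod_factors k
  have h2 := congrArg (fun x : ℚ => (x : ℝ)) this
  push_cast at h2
  rw [h2, al]
  simp [one_div]

lemma al_exp (N : Finset ℕ) (hN : ∀ p ∈ N, Nat.Prime p) :
    1 ≤ al N * Real.exp (2 * ∑ p ∈ N, (1 : ℝ) / p) := by
  have : Real.exp (-(2 * ∑ p ∈ N, (1 : ℝ) / p)) ≤ al N := by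
    rw [mul_sum, ← sum_neg_distrib, Real.exp_sum]
    refine prod_le_prod (fun _ _ => (Real.exp_pos _).le) fun p hp => ?_
    exact exp_bd (by positivity) (one_div_le_one_div_of_le two_pos (two_le (hN p hp)))
  calc (1 : ℝ) = Real.exp (-(2 * ∑ p ∈ N, (1 : ℝ) / p)) * Real.exp (2 * ∑ p ∈ N, (1 : ℝ) / p) := by
        rw [← Real.exp_add]; simp
    _ ≤ _ := mul_le_mul_of_nonneg_right this (Real.exp_pos _).le
end OE

namespace OE
open Finset MeasureTheory

lemma prod_kap (g n c : ℕ) :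
    ∏ p ∈ g.primeFactors, kap n c p =
      al (g.primeFactors.filter (fun p => p ∣ n)) * al (g.primeFactors.filter (fun p => ¬ p ∣ n)) ^ 2 *
        F (g.primeFactors.filter (fun p => ¬ p ∣ n)) c := by
  unfold kap al F
  rw [prod_ite, prod_mul_distrib, prod_pow, mul_assoc]

lemma tot_prod (g q r : ℕ) (hg : 0 < g) (hq : 0 < q) (hr : 0 < r) (hqr : q.Coprime r) :
    al (g * q).primeFactors * al (g * r).primeFactors =
      al (g.primeFactors.filter (fun p => p ∣ q * r)) *
      al (g.primeFactors.filter (fun p => ¬ p ∣ q * r)) ^ 2 * al (q * r).primeFactors := by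
  have hd : Disjoint q.primeFactors r.primeFactors := hqr.disjoint_primeFactors
  have e1 : (g * q).primeFactors ∪ (g * r).primeFactors =
      g.primeFactors.filter (fun p => ¬ p ∣ q * r) ∪ (q * r).primeFactors := by
    ext p
    simp only [mem_union, mem_filter, Nat.mem_primeFactors, ne_eq, mul_eq_zero, hg.ne', hq.ne', hr.ne',
      or_self, not_false_eq_true, and_true]
    constructor
    · rintro (⟨hp, h⟩ | ⟨hp, h⟩)
      · rw [hp.dvd_mul] at *; tauto
      · rw [hp.dvd_mul] at *; tauto
    · rintro (⟨⟨hp, h⟩, _⟩ | ⟨hp, h⟩)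
      · left; exact ⟨hp, h.mul_right q⟩
      · rw [hp.dvd_mul] at h
        rcases h with h | h
        · left; exact ⟨hp, h.mul_left g⟩
        · right; exact ⟨hp, h.mul_left g⟩
  have e2 : (g * q).primeFactors ∩ (g * r).primeFactors = g.primeFactors := by
    rw [Nat.primeFactors_mul hg.ne' hq.ne', Nat.primeFactors_mul hg.ne' hr.ne', ← union_inter_distrib_left,
      disjoint_iff_inter_eq_empty.1 hd, union_empty]
  have e3 : Disjoint (g.primeFactors.filter (fun p => ¬ p ∣ q * r)) (q * r).primeFactors := by
    rw [Finset.disjoint_left]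
    intro p hp hp'
    exact (mem_filter.1 hp).2 (Nat.dvd_of_mem_primeFactors hp')
  unfold al
  rw [← prod_union_inter, e1, e2, prod_union e3, ← prod_filter_mul_prod_filter_not g.primeFactors (fun p => p ∣ q * r)]
  ring

def Sset (g q r : ℕ) (δ Δ : ℝ) : Set ℝ :=
  {x : ℝ | x ∈ Set.Icc (0 : ℝ) 1 ∧ ∃ a b : ℤ, Int.gcd a ((g * q : ℕ) : ℤ) = 1 ∧
    Int.gcd b ((g * r : ℕ) : ℤ) = 1 ∧
    |x - (a : ℝ) / ((g * q : ℕ) : ℝ)| < δ ∧ |x - (b : ℝ) / ((g * r : ℕ) : ℝ)| < Δ}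

lemma S_sub (g q r : ℕ) (hg : 0 < g) (hq : 0 < q) (hr : 0 < r) (hqr : q.Coprime r) (hne : q * r ≠ 1)
    (δ Δ : ℝ) (x : ℝ) (hx : x ∈ Sset g q r δ Δ) :
    ∃ c : ℤ, x ∈ Uset g q r δ Δ c ∧ 1 ≤ c.natAbs ∧
      (c.natAbs : ℝ) ≤ 2 * (((g * q * r : ℕ) : ℝ) * max δ Δ) ∧
      ∀ p ∈ (q * r).primeFactors, ¬ p ∣ c.natAbs := by
  obtain ⟨hx1, a, b, ha, hb, h1, h2⟩ := hx
  have hpr : ∀ p ∈ (q * r).primeFactors, ¬ p ∣ (a * r - b * q).natAbs := by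
    intro p hp hd
    have hpp := Nat.prime_of_mem_primeFactors hp
    have : Fact p.Prime := ⟨hpp⟩
    rw [← Int.natCast_dvd, ← ZMod.intCast_zmod_eq_zero_iff_dvd] at hd
    push_cast at hd
    rcases hpp.dvd_mul.1 (Nat.dvd_of_mem_primeFactors hp) with h | h
    · have h3 := ne_zero_of_gcd p hpp a _ ha (h.mul_left g)
      rw [(ZMod.natCast_eq_zero_iff q p).2 h, mul_zero, sub_zero, mul_eq_zero] at hd
      rcases hd with hd | hd
      · exact h3 hd
      · have := Nat.dvd_gcd h ((ZMod.natCast_eq_zero_iff r p).1 hd)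
        rw [hqr] at this
        exact hpp.one_lt.ne' (Nat.dvd_one.1 this)
    · have h3 := ne_zero_of_gcd p hpp b _ hb (h.mul_left g)
      rw [(ZMod.natCast_eq_zero_iff r p).2 h, mul_zero, zero_sub, neg_eq_zero, mul_eq_zero] at hd
      rcases hd with hd | hd
      · exact h3 hd
      · have := Nat.dvd_gcd ((ZMod.natCast_eq_zero_iff q p).1 hd) h
        rw [hqr] at this
        exact hpp.one_lt.ne' (Nat.dvd_one.1 this)
  refine ⟨a * r - b * q, ⟨hx1, a, b, ha, hb, rfl, h1, h2⟩, ?_, ?_, hpr⟩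
  · rw [Nat.one_le_iff_ne_zero]
    intro h0
    obtain ⟨p, hp, hpd⟩ := Nat.exists_prime_and_dvd hne
    refine hpr p (Nat.mem_primeFactors.2 ⟨hp, hpd, (Nat.mul_pos hq hr).ne'⟩) ?_
    rw [h0]; exact dvd_zero p
  · have hg' : (0 : ℝ) < g := by exact_mod_cast hg
    have hq' : (0 : ℝ) < q := by exact_mod_cast hq
    have hr' : (0 : ℝ) < r := by exact_mod_cast hr
    have e : (((a * r - b * q : ℤ)) : ℝ) = ((g * q * r : ℕ) : ℝ) * ((a : ℝ) / ((g * q : ℕ) : ℝ) - (b : ℝ) / ((g * r : ℕ) : ℝ)) := by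
      push_cast; field_simp
    rw [Nat.cast_natAbs, Int.cast_abs, e, abs_mul, Nat.abs_cast]
    have h3 : |(a : ℝ) / ((g * q : ℕ) : ℝ) - (b : ℝ) / ((g * r : ℕ) : ℝ)| ≤ 2 * max δ Δ := by
      have m1 := le_max_left δ Δ
      have m2 := le_max_right δ Δ
      rw [abs_lt] at h1 h2
      rw [abs_le]
      constructor <;> linarith [h1.1, h1.2, h2.1, h2.2]
    have := mul_le_mul_of_nonneg_left h3 (Nat.cast_nonneg (α := ℝ) (g * q * r))
    linarith

lemma core (C : ℝ) (hC : ∀ N P : Finset ℕ, (∀ p ∈ N, Nat.Prime p) →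
    (∀ p ∈ P, Nat.Prime p) → Disjoint N P → ∀ D : ℝ, 1 / 2 ≤ D → ∀ x : ℝ, 0 ≤ x → x ≤ 2 * D →
    T N P x ≤ al N * x + C * 2 ^ N.card * al N * Real.log (4 * D))
    (g q r : ℕ) (hg : 0 < g) (hq : 0 < q) (hr : 0 < r) (hqr : q.Coprime r) (hne : q * r ≠ 1)
    (δ Δ : ℝ) (hδ : 0 ≤ δ) (hΔ : 0 ≤ Δ) (N : Finset ℕ) (hN : N ⊆ (q * r).primeFactors)
    (D : ℝ) (hD : D = ((g * q * r : ℕ) : ℝ) * max δ Δ) (hD2 : 1 / 2 ≤ D) :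
    (volume (Sset g q r δ Δ)).toReal ≤
      4 * min δ Δ * g * (al (g.primeFactors.filter (fun p => p ∣ q * r)) *
      al (g.primeFactors.filter (fun p => ¬ p ∣ q * r)) ^ 2) * al N *
      (D + C * 2 ^ N.card * Real.log (4 * D)) := by
  set P := g.primeFactors.filter (fun p => ¬ p ∣ q * r) with hP
  set K1 := al (g.primeFactors.filter (fun p => p ∣ q * r)) with hK1
  have hgp : ∀ p ∈ g.primeFactors, p.Prime := fun p hp => Nat.prime_of_mem_primeFactors hp
  have hPp : ∀ p ∈ P, p.Prime := fun p hp => hgp p (mem_filter.1 hp).1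
  have hNp : ∀ p ∈ N, p.Prime := fun p hp => Nat.prime_of_mem_primeFactors (hN hp)
  have hK1p : 0 < K1 := al_pos _ fun p hp => hgp p (mem_filter.1 hp).1
  have hK2p : 0 < al P := al_pos _ hPp
  have hdis : Disjoint N P := by
    rw [Finset.disjoint_left]
    intro p hp hp'
    exact (mem_filter.1 hp').2 (Nat.dvd_of_mem_primeFactors (hN hp))
  set ℓ : ℝ := ((g * q * r : ℕ) : ℝ) with hℓ
  have hℓ0 : 0 < ℓ := by rw [hℓ]; exact_mod_cast Nat.mul_pos (Nat.mul_pos hg hq) hr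
  have hg0 : (0 : ℝ) < g := by exact_mod_cast hg
  set I := (Icc 1 ⌊2 * D⌋₊).filter (fun c => ∀ p ∈ N, ¬ p ∣ c) with hI
  set K := (g : ℝ) * (K1 * al P ^ 2) with hK
  have hK0 : 0 < K := by positivity
  have hterm0 : ∀ c : ℕ, 0 ≤ F P c * ww δ Δ (c / ℓ) := fun c =>
    mul_nonneg (F_nonneg P hPp c) (le_max_left _ _)
  have hU : ∀ c : ℤ, volume (Uset g q r δ Δ c) ≤ ENNReal.ofReal (K * (F P c.natAbs * ww δ Δ (c.natAbs / ℓ))) := by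
    intro c
    refine (vol_U g q r hg hq hr hqr δ Δ c).trans (le_of_eq ?_)
    rw [prod_kap]
    congr 1
    rw [hK]; ring
  have hsub : Sset g q r δ Δ ⊆ ⋃ c ∈ I, (Uset g q r δ Δ (c : ℤ) ∪ Uset g q r δ Δ (-(c : ℤ))) := by
    intro x hx
    obtain ⟨c, hc, hc1, hc2, hc3⟩ := S_sub g q r hg hq hr hqr hne δ Δ x hx
    simp only [Set.mem_iUnion]
    refine ⟨c.natAbs, ?_, ?_⟩
    · rw [hI, mem_filter, mem_Icc]
      exact ⟨⟨hc1, Nat.le_floor (by rw [hD]; exact hc2)⟩, fun p hp => hc3 p (hN hp)⟩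
    · rcases Int.natAbs_eq c with h | h
      · left; rwa [← h]
      · right; rwa [← h]
  have hvol : volume (Sset g q r δ Δ) ≤ ENNReal.ofReal (2 * K * ∑ c ∈ I, F P c * ww δ Δ (c / ℓ)) := by
    calc volume (Sset g q r δ Δ) ≤ ∑ c ∈ I, volume (Uset g q r δ Δ (c : ℤ) ∪ Uset g q r δ Δ (-(c : ℤ))) :=
          (measure_mono hsub).trans (measure_biUnion_finset_le _ _)
      _ ≤ ∑ c ∈ I, ENNReal.ofReal (2 * K * (F P c * ww δ Δ (c / ℓ))) := by
          refine sum_le_sum fun c _ => ?_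
          refine (measure_union_le _ _).trans ?_
          have u1 := hU (c : ℤ)
          have u2 := hU (-(c : ℤ))
          rw [Int.natAbs_neg] at u2
          rw [Int.natAbs_natCast] at u1 u2
          refine (add_le_add u1 u2).trans (le_of_eq ?_)
          have h0 := mul_nonneg hK0.le (hterm0 c)
          rw [← ENNReal.ofReal_add h0 h0]
          congr 1; ring
      _ = _ := by
          rw [← ENNReal.ofReal_sum_of_nonneg, mul_sum]
          intro c _
          exact mul_nonneg (by positivity) (hterm0 c)
  have hlay := layer δ Δ ℓ hδ hΔ hℓ0 I (F P) (al N) (C * 2 ^ N.card * al N * Real.log (4 * D)) (by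
    intro x hx0 hx1
    rw [← hD] at hx1
    have := hC N P hNp hPp hdis D hD2 x hx0 hx1
    refine le_trans (le_of_eq ?_) this
    unfold T
    refine sum_congr ?_ fun _ _ => rfl
    ext c
    rw [hI]
    simp only [mem_filter, mem_Icc]
    rw [Nat.le_floor_iff hx0, Nat.le_floor_iff (by linarith)]
    constructor
    · rintro ⟨⟨⟨h1, _⟩, h2⟩, h3⟩
      exact ⟨⟨h1, h3⟩, h2⟩
    · rintro ⟨⟨h1, h3⟩, h2⟩
      exact ⟨⟨⟨h1, h3.trans hx1⟩, h2⟩, h3⟩)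
  rw [← hD] at hlay
  have hS0 : 0 ≤ 2 * K * ∑ c ∈ I, F P c * ww δ Δ (c / ℓ) :=
    mul_nonneg (by positivity) (sum_nonneg fun c _ => hterm0 c)
  refine (ENNReal.toReal_le_of_le_ofReal hS0 hvol).trans ?_
  refine (mul_le_mul_of_nonneg_left hlay (by positivity)).trans (le_of_eq ?_)
  rw [hK]; ring
end OE

open OE
theorem overlap_estimate :
    ∃ C : ℝ, 0 < C ∧ ∀ ψ : ℕ → ℝ, (∀ q, ψ q ∈ Set.Icc (0 : ℝ) (1 / 2)) →
      ∀ q r : ℕ, 1 ≤ q → 1 ≤ r → q ≠ r → ∀ t : ℝ, 1 ≤ t →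
        (volume (Aset ψ q ∩ Aset ψ r)).toReal ≤
          (if (1 : ℝ) / 2 ≤ Dfun ψ q r then (1 : ℝ) else 0) *
            ((volume (Aset ψ q)).toReal * (volume (Aset ψ r)).toReal *
              Real.exp (2 * Lfun t q r) *
              (1 + C * (2 ^ omegaFun t q r * Real.log (4 * Dfun ψ q r) / Dfun ψ q r))) := by
  obtain ⟨C, hC0, hC⟩ := T_bound
  refine ⟨C, hC0, ?_⟩
  intro ψ hψ Q R hQ hR hQR t ht
  obtain ⟨q, r, hqr, hq, hr⟩ := Nat.exists_coprime Q R
  set g := Nat.gcd Q R with hgdef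
  rw [mul_comm] at hq hr
  have hg : 0 < g := Nat.gcd_pos_of_pos_left _ hQ
  have hq0 : 0 < q := Nat.pos_of_ne_zero fun h => by rw [h] at hq; omega
  have hr0 : 0 < r := Nat.pos_of_ne_zero fun h => by rw [h] at hr; omega
  have hne : q * r ≠ 1 := fun h => hQR (by
    rw [hq, hr, Nat.eq_one_of_mul_eq_one_right h, Nat.eq_one_of_mul_eq_one_left h])
  have hn : Q * R / g ^ 2 = q * r := by
    have : Q * R = q * r * g ^ 2 := by
      conv_lhs => rw [hq, hr]
      ring
    rw [this, Nat.mul_div_cancel _ (by positivity)]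
  have hg' : (0 : ℝ) < g := by exact_mod_cast hg
  have hq' : (0 : ℝ) < q := by exact_mod_cast hq0
  have hr' : (0 : ℝ) < r := by exact_mod_cast hr0
  have hQc : (Q : ℝ) = g * q := by exact_mod_cast hq
  have hRc : (R : ℝ) = g * r := by exact_mod_cast hr
  set δ := ψ Q / Q with hδ
  set Δ := ψ R / R with hΔ
  have hδ0 : 0 ≤ δ := div_nonneg (hψ Q).1 (Nat.cast_nonneg _)
  have hΔ0 : 0 ≤ Δ := div_nonneg (hψ R).1 (Nat.cast_nonneg _)
  have hS : Aset ψ Q ∩ Aset ψ R ⊆ Sset g q r δ Δ := by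
    rintro x ⟨⟨hx, a, ha, h1⟩, ⟨_, b, hb, h2⟩⟩
    refine ⟨hx, a, b, ?_, ?_, ?_, ?_⟩
    · rw [← hq]; exact ha
    · rw [← hr]; exact hb
    · rw [← hq]; exact h1
    · rw [← hr]; exact h2
  have hSfin : volume (Sset g q r δ Δ) ≠ ⊤ := by
    refine ((measure_mono (t := Set.Icc (0 : ℝ) 1) fun x hx => hx.1).trans_lt ?_).ne
    rw [Real.volume_Icc]; exact ENNReal.ofReal_lt_top
  have hD : Dfun ψ Q R = ((g * q * r : ℕ) : ℝ) * max δ Δ := by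
    unfold Dfun
    rw [← hgdef, mul_max_of_nonneg _ _ (Nat.cast_nonneg _), ← max_div_div_right hg'.le, hδ, hΔ, hQc, hRc]
    congr 1
    · push_cast; field_simp
    · push_cast; field_simp
  split_ifs with hD2
  · rw [one_mul]
    set D := Dfun ψ Q R with hDdef
    have hDpos : 0 < D := by linarith
    set N := (q * r).primeFactors.filter (fun p : ℕ => (p : ℝ) ≤ t) with hN
    have hom : omegaFun t Q R = N.card := by
      unfold omegaFun; rw [← hgdef, hn]
    rw [hom]
    set N' := (q * r).primeFactors.filter (fun p : ℕ => t < (p : ℝ)) with hN'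
    have hL : Lfun t Q R = ∑ p ∈ N', (1 : ℝ) / p := by
      unfold Lfun; rw [← hgdef, hn]
    have hnp : ∀ p ∈ (q * r).primeFactors, p.Prime := fun p hp => Nat.prime_of_mem_primeFactors hp
    have hexp := al_exp N' fun p hp => hnp p (Finset.mem_filter.1 hp).1
    rw [← hL] at hexp
    have hNp : ∀ p ∈ N, p.Prime := fun p hp => hnp p (Finset.mem_filter.1 hp).1
    have halN := al_pos N hNp
    have hsplit : al (q * r).primeFactors = al N * al N' := by
      unfold al
      rw [← Finset.prod_filter_mul_prod_filter_not (q * r).primeFactors (fun p : ℕ => (p : ℝ) ≤ t)]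
      simp only [not_le]
      rfl
    have hcore := core C hC g q r hg hq0 hr0 hqr hne δ Δ hδ0 hΔ0 N (Finset.filter_subset _ _) D hD hD2
    have hmono := ENNReal.toReal_mono hSfin (measure_mono hS)
    refine (hmono.trans hcore).trans ?_
    have vQ := vol_A ψ Q hQ (hψ Q).1 (hψ Q).2
    have vR := vol_A ψ R hR (hψ R).1 (hψ R).2
    rw [← hδ] at vQ
    rw [← hΔ] at vR
    have htot := tot_prod g q r hg hq0 hr0 hqr
    set K := al (g.primeFactors.filter (fun p => p ∣ q * r)) *
      al (g.primeFactors.filter (fun p => ¬ p ∣ q * r)) ^ 2 with hK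
    have hK0 : 0 ≤ K := by
      have h1 := al_pos (g.primeFactors.filter (fun p => p ∣ q * r))
        fun p hp => Nat.prime_of_mem_primeFactors (Finset.mem_filter.1 hp).1
      have h2 := al_pos (g.primeFactors.filter (fun p => ¬ p ∣ q * r))
        fun p hp => Nat.prime_of_mem_primeFactors (Finset.mem_filter.1 hp).1
      positivity
    have hprod := mul_le_mul vQ vR (by positivity) ENNReal.toReal_nonneg
    have hlog : 0 ≤ Real.log (4 * D) := Real.log_nonneg (by linarith)
    set W := 1 + C * (2 ^ N.card * Real.log (4 * D) / D) with hW
    have hW0 : 0 ≤ W := by positivity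
    have eW : D + C * 2 ^ N.card * Real.log (4 * D) = D * W := by
      rw [hW]; field_simp
    rw [eW]
    have emm : min δ Δ * max δ Δ = δ * Δ := min_mul_max δ Δ
    have hpr : 2 * (Nat.totient Q : ℝ) * δ * (2 * (Nat.totient R : ℝ) * Δ) =
        4 * (δ * Δ) * (g * (g * q * r)) * K * (al N * al N') := by
      rw [tot_al, tot_al, ← hsplit]
      have hqQ : al Q.primeFactors * al R.primeFactors = K * al (q * r).primeFactors := by
        rw [← htot, ← hq, ← hr]
      rw [hQc, hRc]
      linear_combination (4 * (δ * Δ) * (g * (g * q * r))) * hqQ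
    rw [hpr] at hprod
    have hX0 : 0 ≤ 4 * (δ * Δ) * (g * (g * q * r)) * K * al N := by positivity
    calc 4 * min δ Δ * g * K * al N * (D * W)
        = 4 * (δ * Δ) * (g * (g * q * r)) * K * al N * 1 * W := by
          rw [hD, ← emm]; push_cast; ring
      _ ≤ 4 * (δ * Δ) * (g * (g * q * r)) * K * al N * (al N' * Real.exp (2 * Lfun t Q R)) * W :=
          mul_le_mul_of_nonneg_right (mul_le_mul_of_nonneg_left hexp hX0) hW0
      _ = (4 * (δ * Δ) * (g * (g * q * r)) * K * (al N * al N')) * Real.exp (2 * Lfun t Q R) * W := by ring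
      _ ≤ _ := by
          refine mul_le_mul_of_nonneg_right (mul_le_mul_of_nonneg_right hprod (Real.exp_pos _).le) hW0
  · rw [zero_mul]
    have : Sset g q r δ Δ = ∅ := by
      rw [Set.eq_empty_iff_forall_notMem]
      intro x hx
      obtain ⟨c, _, hc1, hc2, _⟩ := S_sub g q r hg hq0 hr0 hqr hne δ Δ x hx
      rw [← hD] at hc2
      have : (1 : ℝ) ≤ c.natAbs := by exact_mod_cast hc1
      linarith
    rw [this, Set.subset_empty_iff] at hS
    rw [hS]; simp
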